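/- arXiv:0809.0127 — 2 statements merged into one kernel-verified Lean document; each statement's English description precedes it below -/
import Mathlib

section
/- For every fixed integer i ≥ 1, the ratio c_i(m)/u_i(m) tends to 1 as m → ∞, where c_i(m) = d_i(m)^2 / (d_{i-1}(m) · d_{i+1}(m)) and u_i(m) = (1 + 1/i)(1 + 1/(m−i)); here the limit is taken over integers m ≥ i + 1. -/
/-- The Boros-Moll coefficient `d_i(m)`, as a real number:
`d_i(m) = 4^(-m) * sum_{k=0}^m 2^k * C(2m-2k, m-k) * C(m+k, m) * C(k, i)`. -/
noncomputable def d (m i : ℕ) : ℝ :=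
  (∑ k ∈ Finset.range (m + 1),
      (2 : ℝ) ^ k * (Nat.choose (2 * m - 2 * k) (m - k) : ℝ) *
        (Nat.choose (m + k) m : ℝ) * (Nat.choose k i : ℝ)) / 4 ^ m

/-- The weight of `Nat.choose k i` in the sum defining `d m i`. -/
noncomputable def borosMollWeight (m k : ℕ) : ℝ :=
  (2 : ℝ) ^ k * (Nat.choose (2 * m - 2 * k) (m - k) : ℝ) * (Nat.choose (m + k) m : ℝ)

lemma borosMollWeight_nonneg (m k : ℕ) : 0 ≤ borosMollWeight m k := by
  unfold borosMollWeight
  positivity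

lemma d_eq_sum_borosMollWeight (m i : ℕ) :
    d m i = (∑ k ∈ Finset.range (m + 1), borosMollWeight m k * (Nat.choose k i : ℝ)) / 4 ^ m := rfl

lemma d_zero_pos (m : ℕ) : 0 < d m 0 := by
  rw [d_eq_sum_borosMollWeight]
  refine div_pos (Finset.sum_pos' (fun k _ => ?_) ⟨m, by simp, ?_⟩) (by positivity)
  · exact mul_nonneg (borosMollWeight_nonneg m k) (by positivity)
  · have : 0 < Nat.choose (m + m) m := Nat.choose_pos (by omega)
    simp only [borosMollWeight, Nat.sub_self, Nat.choose_self, Nat.choose_zero_right]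
    positivity

lemma borosMollWeight_succ {m k : ℕ} (hk : k < m) :
    (2 * ((m : ℝ) - k) - 1) * (k + 1) * borosMollWeight m (k + 1) =
      ((m : ℝ) - k) * (m + k + 1) * borosMollWeight m k := by
  obtain ⟨p, rfl⟩ : ∃ p, m = p + k + 1 := ⟨m - k - 1, by omega⟩
  have hc : ((p : ℝ) + 1) * (Nat.centralBinom (p + 1) : ℝ) =
      2 * (2 * p + 1) * (Nat.centralBinom p : ℝ) := by
    exact_mod_cast Nat.succ_mul_centralBinom_succ p
  have hb : (Nat.choose (p + k + 1 + k) (p + k + 1) : ℝ) * (p + k + 1 + k + 1) =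
      (Nat.choose (p + k + 1 + k + 1) (p + k + 1) : ℝ) * (k + 1) := by
    have h := Nat.choose_mul_succ_eq (p + k + 1 + k) (p + k + 1)
    rw [show p + k + 1 + k + 1 - (p + k + 1) = k + 1 by omega] at h
    exact_mod_cast h
  unfold borosMollWeight
  rw [show 2 * (p + k + 1) - 2 * (k + 1) = 2 * p by omega,
    show p + k + 1 - (k + 1) = p by omega,
    show 2 * (p + k + 1) - 2 * k = 2 * (p + 1) by omega,
    show p + k + 1 - k = p + 1 by omega, ← add_assoc (p + k + 1) k 1,
    ← Nat.centralBinom_eq_two_mul_choose, ← Nat.centralBinom_eq_two_mul_choose]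
  push_cast
  linear_combination (-2 ^ k * (p + k + 1 + k + 1 : ℝ) *
      (Nat.choose (p + k + 1 + k) (p + k + 1) : ℝ)) * hc -
    (2 * 2 ^ k * (2 * p + 1 : ℝ) * (Nat.centralBinom p : ℝ)) * hb

lemma sum_range_borosMollWeight_mul (m : ℕ) {j : ℕ} (hj : j ≤ m) :
    ∑ k ∈ Finset.range j,
        borosMollWeight m k * (((m : ℝ) - k) ^ 2 + 2 * ((m : ℝ) - k) - m) =
      (2 * ((m : ℝ) - j) + 1) * j * borosMollWeight m j := by
  induction j with
  | zero => simp
  | succ j ih =>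
    rw [Finset.sum_range_succ, ih (by omega)]
    push_cast
    linear_combination -(borosMollWeight_succ (show j < m by omega))

lemma sum_borosMollWeight_mul_sq_le (m : ℕ) :
    ∑ k ∈ Finset.range (m + 1), borosMollWeight m k * ((m : ℝ) - k) ^ 2 ≤
      m * ∑ k ∈ Finset.range (m + 1), borosMollWeight m k := by
  have h0 : ∑ k ∈ Finset.range (m + 1),
      borosMollWeight m k * (((m : ℝ) - k) ^ 2 + 2 * ((m : ℝ) - k) - m) = 0 := by
    rw [Finset.sum_range_succ, sum_range_borosMollWeight_mul m le_rfl]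
    ring
  rw [← sub_nonpos, ← h0, Finset.mul_sum, ← Finset.sum_sub_distrib]
  refine Finset.sum_le_sum fun k hk => ?_
  have hkm : (k : ℝ) ≤ m := by exact_mod_cast Finset.mem_range_succ_iff.mp hk
  nlinarith [mul_nonneg (borosMollWeight_nonneg m k) (sub_nonneg.2 hkm)]

lemma sum_borosMollWeight_mul_le (m : ℕ) :
    ∑ k ∈ Finset.range (m + 1), borosMollWeight m k * ((m : ℝ) - k) ≤
      √m * ∑ k ∈ Finset.range (m + 1), borosMollWeight m k := by
  rcases Nat.eq_zero_or_pos m with rfl | hm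
  · simp
  have hs : 0 < √(m : ℝ) := Real.sqrt_pos.2 (by exact_mod_cast hm)
  have hss : √(m : ℝ) * √(m : ℝ) = m := Real.mul_self_sqrt (by positivity)
  have h : 2 * √(m : ℝ) * ∑ k ∈ Finset.range (m + 1), borosMollWeight m k * ((m : ℝ) - k) ≤
      ∑ k ∈ Finset.range (m + 1), borosMollWeight m k * ((m : ℝ) - k) ^ 2 +
        m * ∑ k ∈ Finset.range (m + 1), borosMollWeight m k := by
    rw [Finset.mul_sum, Finset.mul_sum, ← Finset.sum_add_distrib]
    refine Finset.sum_le_sum fun k _ => ?_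
    have hk := mul_nonneg (borosMollWeight_nonneg m k) (sq_nonneg ((m : ℝ) - k - √m))
    linear_combination hk + borosMollWeight m k * hss
  refine le_of_mul_le_mul_left ?_ (show 0 < 2 * √(m : ℝ) by positivity)
  have h' := sum_borosMollWeight_mul_sq_le m
  calc _ ≤ _ := h
    _ ≤ 2 * (√(m : ℝ) * √(m : ℝ)) * ∑ k ∈ Finset.range (m + 1), borosMollWeight m k := by
      rw [hss]; linarith
    _ = _ := by ring

lemma Nat.mul_choose_sub_le {m k : ℕ} (hk : k ≤ m) (i : ℕ) :
    (m : ℝ) * ((m.choose i : ℝ) - (k.choose i : ℝ)) ≤ ((m : ℝ) - k) * i * (m.choose i : ℝ) := by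
  rcases i with _ | i
  · simp
  rcases m with _ | m
  · obtain rfl : k = 0 := by omega
    simp
  have hstep : ((m + 1).choose (i + 1) : ℝ) - (k.choose (i + 1) : ℝ) ≤
      (((m + 1 : ℕ) : ℝ) - k) * (m.choose i : ℝ) := by
    induction hk using Nat.decreasingInduction with
    | self => simp
    | of_succ k hk ih =>
      have h1 : ((k + 1).choose (i + 1) : ℝ) = k.choose i + k.choose (i + 1) := by
        exact_mod_cast Nat.choose_succ_succ k i
      have h2 : (k.choose i : ℝ) ≤ m.choose i := by
        exact_mod_cast Nat.choose_le_choose i (by omega)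
      push_cast at ih ⊢
      linarith
  have habs : ((m : ℝ) + 1) * (m.choose i : ℝ) = ((m + 1).choose (i + 1) : ℝ) * (i + 1) := by
    exact_mod_cast Nat.add_one_mul_choose_eq m i
  calc _ ≤ ((m + 1 : ℕ) : ℝ) * ((((m + 1 : ℕ) : ℝ) - k) * (m.choose i : ℝ)) := by gcongr
    _ = _ := by
      push_cast
      linear_combination ((m : ℝ) + 1 - k) * habs

lemma d_le_choose_mul_d_zero (m i : ℕ) : d m i ≤ (m.choose i : ℝ) * d m 0 := by
  rw [d_eq_sum_borosMollWeight, d_eq_sum_borosMollWeight, ← mul_div_assoc, Finset.mul_sum]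
  refine div_le_div_of_nonneg_right (Finset.sum_le_sum fun k hk => ?_) (by positivity)
  rw [Nat.choose_zero_right, Nat.cast_one, mul_one, mul_comm]
  have : (k.choose i : ℝ) ≤ m.choose i := by
    exact_mod_cast Nat.choose_le_choose i (Finset.mem_range_succ_iff.mp hk)
  exact mul_le_mul_of_nonneg_right this (borosMollWeight_nonneg m k)

lemma mul_choose_mul_d_zero_sub_d_le (m i : ℕ) :
    (m : ℝ) * ((m.choose i : ℝ) * d m 0 - d m i) ≤ √m * i * ((m.choose i : ℝ) * d m 0) := by
  have h : (m : ℝ) * ((m.choose i : ℝ) * ∑ k ∈ Finset.range (m + 1), borosMollWeight m k -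
      ∑ k ∈ Finset.range (m + 1), borosMollWeight m k * (k.choose i : ℝ)) ≤
      √m * i * ((m.choose i : ℝ) * ∑ k ∈ Finset.range (m + 1), borosMollWeight m k) := by
    calc _ ≤ i * (m.choose i : ℝ) *
          ∑ k ∈ Finset.range (m + 1), borosMollWeight m k * ((m : ℝ) - k) := by
          rw [Finset.mul_sum, Finset.mul_sum, ← Finset.sum_sub_distrib, Finset.mul_sum]
          refine Finset.sum_le_sum fun k hk => ?_
          have := mul_le_mul_of_nonneg_left
            (Nat.mul_choose_sub_le (Finset.mem_range_succ_iff.mp hk) i)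
            (borosMollWeight_nonneg m k)
          linarith
      _ ≤ i * (m.choose i : ℝ) *
          (√m * ∑ k ∈ Finset.range (m + 1), borosMollWeight m k) := by
          gcongr
          exact sum_borosMollWeight_mul_le m
      _ = _ := by ring
  have h4 := div_le_div_of_nonneg_right h (show (0 : ℝ) ≤ 4 ^ m by positivity)
  simp only [d_eq_sum_borosMollWeight, Nat.choose_zero_right, Nat.cast_one, mul_one]
  linear_combination h4

lemma tendsto_d_div_choose_mul_d_zero (i : ℕ) :
    Filter.Tendsto (fun m : ℕ => d m i / ((m.choose i : ℝ) * d m 0)) Filter.atTop (nhds 1) := by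
  have hlow : Filter.Tendsto (fun m : ℕ => 1 - (i : ℝ) / √m) Filter.atTop (nhds 1) := by
    have h := (Real.tendsto_sqrt_atTop.comp
      (tendsto_natCast_atTop_atTop (R := ℝ))).const_div_atTop (i : ℝ)
    simpa using h.const_sub 1
  refine tendsto_of_tendsto_of_tendsto_of_le_of_le' hlow tendsto_const_nhds ?_ ?_
  · filter_upwards [Filter.eventually_ge_atTop (i + 1)] with m hm
    have hc : (0 : ℝ) < (m.choose i : ℝ) * d m 0 :=
      mul_pos (by exact_mod_cast Nat.choose_pos (by omega)) (d_zero_pos m)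
    have hs : 0 < √(m : ℝ) := Real.sqrt_pos.2 (by exact_mod_cast (by omega : 0 < m))
    have hss : √(m : ℝ) * √(m : ℝ) = m := Real.mul_self_sqrt (by positivity)
    have h := mul_choose_mul_d_zero_sub_d_le m i
    rw [← hss, mul_assoc, mul_assoc, hss] at h
    have h' := le_of_mul_le_mul_left h hs
    rw [le_div_iff₀ hc, sub_mul, one_mul, div_mul_eq_mul_div, sub_le_comm, le_div_iff₀ hs]
    linarith
  · filter_upwards [Filter.eventually_ge_atTop (i + 1)] with m hm
    have hc : (0 : ℝ) < (m.choose i : ℝ) * d m 0 :=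
      mul_pos (by exact_mod_cast Nat.choose_pos (by omega)) (d_zero_pos m)
    exact (div_le_one hc).2 (d_le_choose_mul_d_zero m i)

lemma Nat.choose_sq_div_choose_mul_choose {m j : ℕ} (hm : j + 1 < m) :
    (m.choose (j + 1) : ℝ) ^ 2 / ((m.choose j : ℝ) * (m.choose (j + 2) : ℝ)) =
      (1 + 1 / ((j + 1 : ℕ) : ℝ)) * (1 + 1 / ((m : ℝ) - (j + 1 : ℕ))) := by
  obtain ⟨p, rfl⟩ : ∃ p, m = p + j + 2 := ⟨m - j - 2, by omega⟩
  have h1 : ((p + j + 2).choose (j + 1) : ℝ) * (j + 1) =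
      ((p + j + 2).choose j : ℝ) * (p + 2) := by
    have h := Nat.choose_succ_right_eq (p + j + 2) j
    rw [show p + j + 2 - j = p + 2 by omega] at h
    exact_mod_cast h
  have h2 : ((p + j + 2).choose (j + 2) : ℝ) * (j + 2) =
      ((p + j + 2).choose (j + 1) : ℝ) * (p + 1) := by
    have h := Nat.choose_succ_right_eq (p + j + 2) (j + 1)
    rw [show p + j + 2 - (j + 1) = p + 1 by omega] at h
    exact_mod_cast h
  have hpos : (0 : ℝ) < (p + j + 2).choose j := by
    exact_mod_cast Nat.choose_pos (by omega)
  have hpos2 : (0 : ℝ) < (p + j + 2).choose (j + 2) := by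
    exact_mod_cast Nat.choose_pos (by omega)
  have hp : ((p + j + 2 : ℕ) : ℝ) - (j + 1 : ℕ) = p + 1 := by push_cast; ring
  rw [hp, div_eq_iff (by positivity)]
  push_cast
  field_simp
  linear_combination ((p + 1) * ((p + j + 2).choose (j + 1) : ℝ)) * h1 -
    ((p + j + 2).choose j : ℝ) * (p + 2) * h2

theorem boros_moll_c_div_u_tendsto_one (i : ℕ) (hi : 1 ≤ i) :
    Filter.Tendsto
      (fun m : ℕ =>
        (d m i ^ 2 / (d m (i - 1) * d m (i + 1))) /
          ((1 + 1 / (i : ℝ)) * (1 + 1 / ((m : ℝ) - i))))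
      Filter.atTop (nhds 1) := by
  obtain ⟨j, rfl⟩ : ∃ j, i = j + 1 := ⟨i - 1, by omega⟩
  have h := ((tendsto_d_div_choose_mul_d_zero (j + 1)).pow 2).div
    ((tendsto_d_div_choose_mul_d_zero j).mul (tendsto_d_div_choose_mul_d_zero (j + 2)))
    (by norm_num)
  norm_num only at h
  refine h.congr' ?_
  filter_upwards [Filter.eventually_ge_atTop (j + 2)] with m hm
  have hpos {l : ℕ} (hl : l ≤ m) : (m.choose l : ℝ) ≠ 0 := by
    exact_mod_cast (Nat.choose_pos hl).ne'
  have h0 := hpos (show j ≤ m by omega)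
  have h1 := hpos (show j + 1 ≤ m by omega)
  have h2 := hpos hm
  have hd := (d_zero_pos m).ne'
  rw [← Nat.choose_sq_div_choose_mul_choose (show j + 1 < m by omega), Nat.add_sub_cancel]
  simp only [Pi.div_apply]
  field_simp
end

section
/- For every integer m ≥ 2 and every integer i with 1 ≤ i ≤ m−1, one has d_i(m+1)/d_i(m) > Q(m,i), where Q(m,i) = (4m^2 + 7m + i + 3) / (2(m+1−i)(m+1)). -/
/-- `Q(m,i) = (4m^2 + 7m + i + 3) / (2(m+1-i)(m+1))`. -/
noncomputable def Q (m i : ℕ) : ℝ :=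
  (4 * (m : ℝ) ^ 2 + 7 * m + i + 3) / (2 * ((m : ℝ) + 1 - i) * ((m : ℝ) + 1))

/-- A common hypergeometric base for the summands of `d m i`, `d (m + 1) i` and `d (m + 2) i`:
each of these is a rational function of `m` and `k` times this base. -/
noncomputable def borosMollBase (m i k : ℕ) : ℝ :=
  2 ^ k * (Nat.centralBinom (m + 2 - k) : ℝ) * ((m + k).choose m : ℝ) * (k.choose i : ℝ)

/-- The polynomial factor of the Zeilberger certificate. -/
noncomputable def borosMollCert (m i k : ℝ) : ℝ :=
  16 * (m + 2 - i) * (k - m - 2) * (k + m + 1)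
    + 8 * (2 * m + 3) * (m + 2 + (2 * m + 1) * (m + 2 - k))

lemma two_mul_natCast_ne_odd (j : ℕ) (c : ℤ) : 2 * (j : ℝ) - (2 * c + 1) ≠ 0 := by
  intro h
  have h' : 2 * (j : ℤ) - (2 * c + 1) = 0 := by exact_mod_cast h
  omega

lemma centralBinom_succ_real (j : ℕ) :
    ((j : ℝ) + 1) * (Nat.centralBinom (j + 1) : ℝ) = 2 * (2 * j + 1) * Nat.centralBinom j := by
  exact_mod_cast Nat.succ_mul_centralBinom_succ j

lemma choose_add_succ_top_real (m k : ℕ) :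
    ((m : ℝ) + 1) * ((m + 1 + k).choose (m + 1) : ℝ) = (m + k + 1) * ((m + k).choose m : ℝ) := by
  have h := Nat.add_one_mul_choose_eq (m + k) m
  rw [show m + k + 1 = m + 1 + k by ring] at h
  have h' : ((m + 1 + k : ℕ) : ℝ) * ((m + k).choose m : ℝ)
      = ((m + 1 + k).choose (m + 1) : ℝ) * ((m + 1 : ℕ) : ℝ) := by exact_mod_cast h
  push_cast at h'
  linarith

lemma choose_add_succ_right_real (m k : ℕ) :
    ((k : ℝ) + 1) * ((m + (k + 1)).choose m : ℝ) = (m + k + 1) * ((m + k).choose m : ℝ) := by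
  have h := Nat.choose_mul_succ_eq (m + k) m
  rw [show m + k + 1 - m = k + 1 by omega, show m + k + 1 = m + (k + 1) by ring] at h
  have h' : ((m + k).choose m : ℝ) * ((m + (k + 1) : ℕ) : ℝ)
      = ((m + (k + 1)).choose m : ℝ) * ((k + 1 : ℕ) : ℝ) := by exact_mod_cast h
  push_cast at h'
  linarith

lemma succ_choose_real (k i : ℕ) :
    ((k : ℝ) + 1 - i) * ((k + 1).choose i : ℝ) = (k + 1) * (k.choose i : ℝ) := by
  rcases le_or_gt i (k + 1) with hik | hik
  · have h := Nat.choose_mul_succ_eq k i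
    have h' : (k.choose i : ℝ) * ((k + 1 : ℕ) : ℝ)
        = ((k + 1).choose i : ℝ) * ((k + 1 - i : ℕ) : ℝ) := by exact_mod_cast h
    push_cast [Nat.cast_sub hik] at h'
    linarith
  · rw [Nat.choose_eq_zero_of_lt hik, Nat.choose_eq_zero_of_lt (by omega : k < i)]
    simp

lemma borosMollBase_succ (m i k : ℕ) (hk : k ≤ m + 1) :
    (2 * ((m : ℝ) - k) + 3) * (k + 1 - i) * borosMollBase m i (k + 1)
      = (m - k + 2) * (m + k + 1) * borosMollBase m i k := by
  obtain ⟨j, hj⟩ : ∃ j, m + 1 = k + j := ⟨m + 1 - k, by omega⟩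
  have hjR : (m : ℝ) + 1 = k + j := by exact_mod_cast hj
  have h1 := centralBinom_succ_real j
  have h2 := choose_add_succ_right_real m k
  have h3 := succ_choose_real k i
  have hk1 : (k : ℝ) + 1 ≠ 0 := by positivity
  unfold borosMollBase
  rw [show m + 2 - k = j + 1 by omega, show m + 2 - (k + 1) = j by omega, pow_succ,
    show (m : ℝ) - k = j - 1 by linarith]
  apply mul_left_cancel₀ hk1
  set A := (Nat.centralBinom j : ℝ)
  set A' := (Nat.centralBinom (j + 1) : ℝ)
  set B := ((m + k).choose m : ℝ)
  set B' := ((m + (k + 1)).choose m : ℝ)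
  set E := (k.choose i : ℝ)
  set E' := ((k + 1).choose i : ℝ)
  calc _ = 2 ^ k * (2 * (2 * j + 1) * A) * ((k + 1) * B') * ((k + 1 - i) * E') := by ring
    _ = 2 ^ k * ((j + 1) * A') * ((m + k + 1) * B) * ((k + 1) * E) := by rw [← h1, h2, h3]
    _ = _ := by ring

/-- The combination of the summands appearing in the recurrence telescopes. -/
lemma sum_borosMollBase (m i K : ℕ) (hK : K ≤ m + 2) :
    ∑ k ∈ Finset.range K,
      (4 * ((m : ℝ) + 2 - i) * (m + k + 1) * (m + k + 2)
        - 4 * (8 * m ^ 2 + 24 * m + 19 - 4 * i ^ 2) * (m - k + 2) * (m + k + 1)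
          / (2 * (m - k) + 3)
        + 4 * ((m + i + 1) * (4 * m + 3) * (4 * m + 5)) * (m - k + 1) * (m - k + 2)
          / ((2 * (m - k) + 1) * (2 * (m - k) + 3))) * borosMollBase m i k
      = (K - i) * borosMollCert m i K / (2 * (m - K) + 3) * borosMollBase m i K := by
  induction K with
  | zero =>
    rcases Nat.eq_zero_or_pos i with rfl | hi
    · simp
    · simp [borosMollBase, Nat.choose_eq_zero_of_lt hi]
  | succ k ih =>
    rw [Finset.sum_range_succ, ih (by omega)]
    have h := borosMollBase_succ m i k (by omega)
    obtain ⟨j, hj⟩ : ∃ j, m + 1 = k + j := ⟨m + 1 - k, by omega⟩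
    have hm : (m : ℝ) = k + j - 1 := by
      have : (m : ℝ) + 1 = k + j := by exact_mod_cast hj
      linarith
    have e1 : 2 * ((m : ℝ) - k) + 1 ≠ 0 := by
      have := two_mul_natCast_ne_odd j 0
      rw [hm]; convert this using 1; push_cast; ring
    have e3 : 2 * ((m : ℝ) - k) + 3 ≠ 0 := by
      have := two_mul_natCast_ne_odd j (-1)
      rw [hm]; convert this using 1; push_cast; ring
    have e1' : 2 * ((m : ℝ) - (k + 1)) + 3 = 2 * (m - k) + 1 := by ring
    push_cast
    rw [e1']
    have h' : (k + 1 - i) * borosMollCert m i (k + 1) / (2 * ((m : ℝ) - k) + 1)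
          * borosMollBase m i (k + 1)
        = borosMollCert m i (k + 1) * ((m - k + 2) * (m + k + 1) * borosMollBase m i k)
          / ((2 * (m - k) + 1) * (2 * (m - k) + 3)) := by
      rw [← h]; field_simp
    rw [h']
    unfold borosMollCert
    field_simp
    ring

lemma four_pow_mul_d (m i : ℕ) :
    4 ^ m * d m i = ∑ k ∈ Finset.range (m + 1),
      (2 : ℝ) ^ k * (Nat.centralBinom (m - k) : ℝ) * ((m + k).choose m : ℝ) * (k.choose i : ℝ) := by
  unfold d
  rw [mul_div_cancel₀ _ (by positivity)]
  refine Finset.sum_congr rfl fun k _ => ?_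
  rw [Nat.centralBinom, Nat.mul_sub]

lemma four_pow_mul_d_eq_sum_base (m i : ℕ) :
    4 ^ m * d m i = ∑ k ∈ Finset.range (m + 3),
      ((m : ℝ) - k + 1) * (m - k + 2) / (4 * ((2 * (m - k) + 1) * (2 * (m - k) + 3)))
        * borosMollBase m i k := by
  rw [four_pow_mul_d, Finset.sum_range_succ _ (m + 2), Finset.sum_range_succ _ (m + 1)]
  have z1 : (m : ℝ) - (m + 1 : ℕ) + 1 = 0 := by push_cast; ring
  have z2 : (m : ℝ) - (m + 2 : ℕ) + 2 = 0 := by push_cast; ring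
  rw [z1, z2]
  simp only [zero_mul, mul_zero, zero_div, add_zero]
  refine Finset.sum_congr rfl fun k hk => ?_
  obtain ⟨j, rfl⟩ : ∃ j, m = k + j := ⟨m - k, by grind⟩
  have h1 := centralBinom_succ_real j
  have h2 := centralBinom_succ_real (j + 1)
  unfold borosMollBase
  rw [show k + j - k = j by omega, show k + j + 2 - k = j + 1 + 1 by omega]
  push_cast at h2 ⊢
  rw [show (k : ℝ) + j - k = j by ring]
  have h3 : (4 * ((2 * (j : ℝ) + 1) * (2 * j + 3))) * Nat.centralBinom j
      = (j + 1) * (j + 2) * Nat.centralBinom (j + 1 + 1) := by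
    linear_combination (-2 * (2 * (j : ℝ) + 3)) * h1 - ((j : ℝ) + 1) * h2
  have h4 : (Nat.centralBinom j : ℝ)
      = (j + 1) * (j + 2) / (4 * ((2 * (j : ℝ) + 1) * (2 * j + 3)))
        * Nat.centralBinom (j + 1 + 1) := by
    field_simp
    linarith
  rw [h4]; ring

lemma four_pow_succ_mul_d_eq_sum_base (m i : ℕ) :
    4 ^ (m + 1) * d (m + 1) i = ∑ k ∈ Finset.range (m + 3),
      ((m : ℝ) - k + 2) * (m + k + 1) / (2 * (m + 1) * (2 * (m - k) + 3))
        * borosMollBase m i k := by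
  rw [four_pow_mul_d, Finset.sum_range_succ _ (m + 2)]
  have z2 : (m : ℝ) - (m + 2 : ℕ) + 2 = 0 := by push_cast; ring
  rw [z2]
  simp only [zero_mul, zero_div, add_zero]
  refine Finset.sum_congr rfl fun k hk => ?_
  obtain ⟨j, hj⟩ : ∃ j, m + 1 = k + j := ⟨m + 1 - k, by grind⟩
  have hm : (m : ℝ) = k + j - 1 := by
    have : (m : ℝ) + 1 = k + j := by exact_mod_cast hj
    linarith
  have h1 := centralBinom_succ_real j
  have h2 := choose_add_succ_top_real m k
  unfold borosMollBase
  rw [show m + 1 - k = j by omega, show m + 2 - k = j + 1 by omega]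
  rw [show (m : ℝ) - k = j - 1 by linarith]
  have h3 : (Nat.centralBinom j : ℝ)
      = (j + 1) / (2 * (2 * j + 1)) * (Nat.centralBinom (j + 1) : ℝ) := by
    field_simp
    linarith
  have h4 : ((m + 1 + k).choose (m + 1) : ℝ)
      = (m + k + 1) / (m + 1) * ((m + k).choose m : ℝ) := by
    field_simp
    linarith
  rw [h3, h4, show 2 * ((j : ℝ) - 1) + 3 = 2 * j + 1 by ring]
  field_simp
  ring

lemma four_pow_add_two_mul_d_eq_sum_base (m i : ℕ) :
    4 ^ (m + 2) * d (m + 2) i = ∑ k ∈ Finset.range (m + 3),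
      ((m : ℝ) + k + 1) * (m + k + 2) / ((m + 1) * (m + 2)) * borosMollBase m i k := by
  rw [four_pow_mul_d]
  refine Finset.sum_congr rfl fun k _ => ?_
  have h1 := choose_add_succ_top_real m k
  have h2 := choose_add_succ_top_real (m + 1) k
  unfold borosMollBase
  have h4 : ((m + 2 + k).choose (m + 2) : ℝ)
      = (m + k + 1) * (m + k + 2) / ((m + 1) * (m + 2)) * ((m + k).choose m : ℝ) := by
    push_cast at h2
    field_simp
    rw [show m + 1 + 1 = m + 2 from rfl] at h2
    linear_combination ((m : ℝ) + 1) * h2 + ((m : ℝ) + k + 2) * h1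
  rw [h4]; ring

/-- The second order recurrence in `m` for the Boros-Moll coefficients. -/
lemma d_recurrence (m i : ℕ) :
    4 * ((m : ℝ) + 2 - i) * (m + 1) * (m + 2) * d (m + 2) i
      - 2 * (m + 1) * (8 * m ^ 2 + 24 * m + 19 - 4 * i ^ 2) * d (m + 1) i
      + (m + i + 1) * (4 * m + 3) * (4 * m + 5) * d m i = 0 := by
  have hs := sum_borosMollBase m i (m + 2) le_rfl
  have h0 := four_pow_mul_d_eq_sum_base m i
  have h1 := four_pow_succ_mul_d_eq_sum_base m i
  have h2 := four_pow_add_two_mul_d_eq_sum_base m i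
  have key : 4 * ((m : ℝ) + 2 - i) * (m + 1) * (m + 2) * (4 ^ (m + 2) * d (m + 2) i)
      - 8 * (m + 1) * (8 * m ^ 2 + 24 * m + 19 - 4 * i ^ 2) * (4 ^ (m + 1) * d (m + 1) i)
      + 16 * ((m + i + 1) * (4 * m + 3) * (4 * m + 5)) * (4 ^ m * d m i) = 0 := by
    rw [h0, h1, h2, Finset.mul_sum, Finset.mul_sum, Finset.mul_sum, ← Finset.sum_sub_distrib,
      ← Finset.sum_add_distrib, Finset.sum_range_succ]
    rw [← sub_eq_zero] at hs
    refine Eq.trans ?_ hs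
    rw [sub_eq_add_neg]
    congr 1
    · refine Finset.sum_congr rfl fun k _ => ?_
      field_simp
      ring
    · unfold borosMollCert
      push_cast
      rw [show (m : ℝ) - (m + 2) = -2 by ring]
      field_simp
      ring
  have h4 : (4 : ℝ) ^ m ≠ 0 := by positivity
  apply mul_left_cancel₀ (mul_ne_zero (by norm_num : (16 : ℝ) ≠ 0) h4)
  rw [mul_zero, ← key]
  ring

lemma d_pos {m i : ℕ} (h : i ≤ m) : 0 < d m i := by
  unfold d
  refine div_pos (Finset.sum_pos' (fun k _ => by positivity) ⟨m, by simp, ?_⟩) (by positivity)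
  have h1 : 0 < (m + m).choose m := Nat.choose_pos (by omega)
  have h2 : 0 < m.choose i := Nat.choose_pos h
  simp only [Nat.sub_self, Nat.choose_self, Nat.cast_one]
  positivity

lemma d_self (i : ℕ) : 4 ^ i * d i i = 2 ^ i * (Nat.centralBinom i : ℝ) := by
  rw [four_pow_mul_d, Finset.sum_range_succ, Finset.sum_eq_zero]
  · simp [Nat.centralBinom, two_mul]
  · intro k hk
    rw [Nat.choose_eq_zero_of_lt (Finset.mem_range.mp hk)]
    simp

lemma d_succ_self (i : ℕ) :
    2 * ((i : ℝ) + 1) * d (i + 1) i = (2 * i + 1) * (2 * i + 3) * d i i := by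
  have h0 := d_self i
  have h1 := four_pow_mul_d (i + 1) i
  rw [Finset.sum_range_succ, Finset.sum_range_succ, Finset.sum_eq_zero, zero_add] at h1
  swap
  · intro k hk
    rw [Nat.choose_eq_zero_of_lt (Finset.mem_range.mp hk)]
    simp
  have hc := centralBinom_succ_real i
  have ht := choose_add_succ_top_real i i
  rw [show i + 1 - i = 1 by omega, Nat.sub_self,
    show (i + 1 + (i + 1)).choose (i + 1) = Nat.centralBinom (i + 1) by
      rw [Nat.centralBinom, two_mul]] at h1
  rw [show (i + i).choose i = Nat.centralBinom i by rw [Nat.centralBinom, two_mul]] at ht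
  simp only [Nat.centralBinom_zero, show Nat.centralBinom 1 = 2 from rfl, Nat.choose_self,
    Nat.choose_succ_self_right] at h1
  push_cast at h1
  have h4 : (4 : ℝ) ^ i ≠ 0 := by positivity
  apply mul_left_cancel₀ h4
  rw [pow_succ, pow_succ] at h1
  linear_combination ((i : ℝ) + 1) / 2 * h1 + 2 ^ i * ht + 2 ^ i * ((i : ℝ) + 1) * hc
    - (2 * (i : ℝ) + 1) * (2 * i + 3) * h0

/-- If `d (m + 1) i / d m i ≥ Q m i`, then `d (m + 2) i / d (m + 1) i > Q (m + 1) i`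
(both in cross-multiplied form). -/
lemma d_succ_strict_of_le {m i : ℕ} (him : i ≤ m) (hi : 1 ≤ i)
    (h : (4 * (m : ℝ) ^ 2 + 7 * m + i + 3) * d m i
      ≤ 2 * ((m : ℝ) + 1 - i) * (m + 1) * d (m + 1) i) :
    (4 * ((m : ℝ) + 1) ^ 2 + 7 * (m + 1) + i + 3) * d (m + 1) i
      < 2 * ((m : ℝ) + 2 - i) * (m + 2) * d (m + 2) i := by
  have hr := d_recurrence m i
  have hp : 0 < d (m + 1) i := d_pos (by omega)
  have hiR : (1 : ℝ) ≤ i := by exact_mod_cast hi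
  have hmR : (i : ℝ) ≤ m := by exact_mod_cast him
  have hP : 0 < 2 * ((m : ℝ) + 1) * (4 * (m : ℝ) ^ 2 + 7 * m + i + 3) := by positivity
  have hD : 0 ≤ ((m : ℝ) + i + 1) * (4 * m + 3) * (4 * m + 5) := by positivity
  have hgap : 0 < 4 * ((m : ℝ) + 1) * i * (m + 1 + i + 2 * i * (m - i)) * d (m + 1) i := by
    have : 0 ≤ (m : ℝ) - i := by linarith
    positivity
  rw [← sub_pos]
  refine pos_of_mul_pos_right ?_ hP.le
  have hmul := mul_le_mul_of_nonneg_left h hD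
  linear_combination hmul + hgap - (4 * (m : ℝ) ^ 2 + 7 * m + i + 3) * hr

lemma d_ratio_weak {m i : ℕ} (him : i ≤ m) (hi : 1 ≤ i) :
    (4 * (m : ℝ) ^ 2 + 7 * m + i + 3) * d m i
      ≤ 2 * ((m : ℝ) + 1 - i) * (m + 1) * d (m + 1) i := by
  induction m, him using Nat.le_induction with
  | base => linear_combination -(d_succ_self i)
  | succ m him ih =>
    have := (d_succ_strict_of_le him hi ih).le
    push_cast
    linear_combination this

theorem boros_moll_ratio_gt_Q (m i : ℕ) (hm : 2 ≤ m) (hi : 1 ≤ i) (hi' : i ≤ m - 1) :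
    d (m + 1) i / d m i > Q m i := by
  obtain ⟨n, rfl⟩ : ∃ n, m = n + 1 := ⟨m - 1, by omega⟩
  have him : i ≤ n := by omega
  have h := d_succ_strict_of_le him hi (d_ratio_weak him hi)
  have hR : (i : ℝ) ≤ n := by exact_mod_cast him
  have hpos : 0 < 2 * (((n + 1 : ℕ) : ℝ) + 1 - i) * (((n + 1 : ℕ) : ℝ) + 1) := by
    push_cast
    have : 0 < (n : ℝ) + 1 + 1 - i := by linarith
    positivity
  unfold Q
  rw [gt_iff_lt, div_lt_div_iff₀ hpos (d_pos (by omega))]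
  push_cast
  linear_combination h
end
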